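/- Every orientable nonsingular coloring λ : V → (ℤ/2)⁴ \ {0} of the facet-adjacency graph G of the 120-cell has a range of cardinality exactly 8, and there exists g ∈ GL₄(ℤ/2) such that the range of g∘λ is exactly the set of the eight odd-weight vectors {e₁, e₂, e₃, e₄, e₁+e₂+e₃, e₁+e₂+e₄, e₁+e₃+e₄, e₂+e₃+e₄} of (ℤ/2)⁴. -/

import Mathlib

open Quaternion

noncomputable section

/-- The golden ratio. -/
def gold : ℝ := (1 + Real.sqrt 5) / 2

/-- The coordinates of a quaternion, viewed as a vector in `ℝ⁴`. -/
def qcoords (q : ℍ[ℝ]) : Fin 4 → ℝ := ![q.re, q.imI, q.imJ, q.imK]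

/-- The standard inner product of two quaternions viewed as vectors in `ℝ⁴`. -/
def qinner (p q : ℍ[ℝ]) : ℝ := ∑ i, qcoords p i * qcoords q i

/-- A choice of signs. -/
def IsSign (s : Fin 4 → ℝ) : Prop := ∀ i, s i = 1 ∨ s i = -1

/-- The coordinate multiset `(0, 1, φ⁻¹, φ)`. -/
def baseVec : Fin 4 → ℝ := ![0, 1, gold⁻¹, gold]

/-- The 120 facet centers of the right-angled 120-cell: the 24 Hurwitz units
`±1, ±i, ±j, ±k, (±1±i±j±k)/2` together with the 96 quaternions obtained from
`(0 ± i ± φ⁻¹j ± φk)/2` by even permutations of the coordinates `(0,1,φ⁻¹,φ)`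
and all choices of signs. -/
def Vcell : Set ℍ[ℝ] :=
  {q | (∃ s : Fin 4 → ℝ, IsSign s ∧
          ((∃ i : Fin 4, ∀ j, qcoords q j = if j = i then s i else 0) ∨
           (∀ j, qcoords q j = s j / 2))) ∨
       (∃ σ : Equiv.Perm (Fin 4), σ ∈ alternatingGroup (Fin 4) ∧
          ∃ s : Fin 4 → ℝ, IsSign s ∧ ∀ j, qcoords q j = s j * baseVec (σ j) / 2)}

/-- Facet adjacency in the 120-cell: two facet centers are adjacent iff their
inner product equals `φ/2 = cos (π/5)`. -/
def Adj (p q : ℍ[ℝ]) : Prop := p ∈ Vcell ∧ q ∈ Vcell ∧ qinner p q = gold / 2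

/-- A nonsingular coloring (characteristic function) of the 120-cell: facets get
nonzero colors in `(ℤ/2)⁴` and any four pairwise adjacent facets get a basis. -/
def Nonsingular (lam : ℍ[ℝ] → (Fin 4 → ZMod 2)) : Prop :=
  (∀ q ∈ Vcell, lam q ≠ 0) ∧
  ∀ a b c d : ℍ[ℝ], Adj a b → Adj a c → Adj a d → Adj b c → Adj b d → Adj c d →
    LinearIndependent (ZMod 2) ![lam a, lam b, lam c, lam d]

/-- The symmetry group of the 120-cell, realized as the permutations of `Vcell`
of the form `x ↦ pxq` or `x ↦ p x̄ q` with `p, q ∈ Vcell`. -/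
def SymE : Set (ℍ[ℝ] → ℍ[ℝ]) :=
  {f | ∃ p ∈ Vcell, ∃ q ∈ Vcell,
        (f = fun x => p * x * q) ∨ (f = fun x => p * star x * q)}

/-- DJ-equivalence of colorings: `λ = g ∘ μ ∘ a` on the facets, for some
`g ∈ GL₄(ℤ/2)` and some symmetry `a` of the 120-cell. -/
def DJEquiv (lam mu : ℍ[ℝ] → (Fin 4 → ZMod 2)) : Prop :=
  ∃ g : (Fin 4 → ZMod 2) ≃ₗ[ZMod 2] (Fin 4 → ZMod 2),
    ∃ a ∈ SymE, ∀ x ∈ Vcell, lam x = g (mu (a x))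

/-- Orientability (Nakayama–Nishimura): after a change of basis every color has
odd weight. -/
def OrientableColoring (lam : ℍ[ℝ] → (Fin 4 → ZMod 2)) : Prop :=
  ∃ g : (Fin 4 → ZMod 2) ≃ₗ[ZMod 2] (Fin 4 → ZMod 2),
    ∀ x ∈ Vcell, ∑ i, g (lam x) i = 1


/-- The standard basis of `(ℤ/2)⁴`. -/
def e (i : Fin 4) : Fin 4 → ZMod 2 := Pi.single i 1


/-! ### A verified backtracking search

We fix 26 of the facets.  Elements of `ℤ[φ]` are pairs `(a, b)` standing for `a + b φ`;
the facets are stored with all coordinates doubled. -/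

/-- The doubled coordinates of the 26 facets used by the search; the first four are
pairwise adjacent. -/
def pts : List (Fin 4 → ℤ × ℤ) :=
  [![(2, 0), (0, 0), (0, 0), (0, 0)],
   ![(0, 1), (-1, 0), (0, 0), (-1, 1)],
   ![(0, 1), (-1, 0), (0, 0), (1, -1)],
   ![(0, 1), (1, -1), (-1, 0), (0, 0)],
   ![(0, 1), (1, -1), (1, 0), (0, 0)],
   ![(0, 1), (0, 0), (1, -1), (1, 0)],
   ![(0, 1), (0, 0), (-1, 1), (1, 0)],
   ![(0, 1), (-1, 1), (1, 0), (0, 0)],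
   ![(0, 1), (1, 0), (0, 0), (-1, 1)],
   ![(0, 1), (0, 0), (-1, 1), (-1, 0)],
   ![(0, 1), (1, 0), (0, 0), (1, -1)],
   ![(0, 1), (0, 0), (1, -1), (-1, 0)],
   ![(0, 1), (-1, 1), (-1, 0), (0, 0)],
   ![(1, 0), (1, -1), (0, 0), (0, 1)],
   ![(1, 0), (-1, 0), (1, 0), (1, 0)],
   ![(1, 0), (0, 0), (0, 1), (-1, 1)],
   ![(1, 0), (-1, 1), (0, 0), (0, 1)],
   ![(1, 0), (1, 0), (1, 0), (1, 0)],
   ![(-1, 1), (0, 0), (1, 0), (0, 1)],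
   ![(1, 0), (0, 0), (0, 1), (1, -1)],
   ![(1, 0), (0, 1), (-1, 1), (0, 0)],
   ![(1, 0), (1, 0), (1, 0), (-1, 0)],
   ![(-1, 1), (1, 0), (0, 1), (0, 0)],
   ![(-1, 1), (-1, 0), (0, 1), (0, 0)],
   ![(1, 0), (-1, 0), (1, 0), (-1, 0)],
   ![(1, 0), (0, -1), (-1, 1), (0, 0)]]

/-- The `n`-th facet of the search. -/
def pt (n : ℕ) : Fin 4 → ℤ × ℤ := pts.getD n (fun _ => 0)

/-- Multiplication in `ℤ[φ]`. -/
def mulZ (x y : ℤ × ℤ) : ℤ × ℤ :=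
  (x.1 * y.1 + x.2 * y.2, x.1 * y.2 + x.2 * y.1 + x.2 * y.2)

/-- The doubled coordinates `(0, 1, φ⁻¹, φ)`. -/
def baseZ : Fin 4 → ℤ × ℤ := ![(0, 0), (1, 0), (-1, 1), (0, 1)]

/-- The sign of the coordinates that occur. -/
def sgZ (x : ℤ × ℤ) : ℤ := if x.1 + 2 * x.2 < 0 then -1 else 1

/-- Membership in `Vcell`, in exact arithmetic. -/
def MemZ (p : Fin 4 → ℤ × ℤ) : Prop :=
  (∃ i : Fin 4, ∀ j, p j = if j = i then (2 * sgZ (p i), 0) else (0, 0)) ∨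
  (∀ j, p j = (sgZ (p j), 0)) ∨
  ∃ σ : Equiv.Perm (Fin 4),
    (∀ j, p j = (sgZ (p j) * (baseZ (σ j)).1, sgZ (p j) * (baseZ (σ j)).2)) ∧
    Equiv.Perm.sign σ = 1

instance (p : Fin 4 → ℤ × ℤ) : Decidable (MemZ p) := by
  unfold MemZ; infer_instance

/-- Adjacency, in exact arithmetic. -/
def adjZ (p q : Fin 4 → ℤ × ℤ) : Bool :=
  decide (mulZ (p 0) (q 0) + mulZ (p 1) (q 1) + mulZ (p 2) (q 2) + mulZ (p 3) (q 3) = (0, 2))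

/-- The real number `a + b φ`. -/
def evZ (x : ℤ × ℤ) : ℝ := x.1 + x.2 * gold

/-- The quaternion with given doubled coordinates. -/
def toQ (p : Fin 4 → ℤ × ℤ) : ℍ[ℝ] :=
  ⟨evZ (p 0) / 2, evZ (p 1) / 2, evZ (p 2) / 2, evZ (p 3) / 2⟩

theorem gold_sq : gold * gold = gold + 1 := by
  have h : Real.sqrt 5 * Real.sqrt 5 = 5 := Real.mul_self_sqrt (by norm_num)
  unfold gold
  nlinarith

theorem gold_pos : 0 < gold := by
  have h := Real.sqrt_nonneg 5
  unfold gold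
  linarith

theorem gold_inv : gold⁻¹ = gold - 1 := by
  have h := gold_pos
  have h2 := gold_sq
  field_simp
  nlinarith

theorem qcoords_toQ (p : Fin 4 → ℤ × ℤ) (j : Fin 4) : qcoords (toQ p) j = evZ (p j) / 2 := by
  fin_cases j <;> rfl

theorem evZ_mul (x y : ℤ × ℤ) : evZ (mulZ x y) = evZ x * evZ y := by
  unfold evZ mulZ
  push_cast
  linear_combination (-(x.2 : ℝ) * y.2) * gold_sq

theorem evZ_add (x y : ℤ × ℤ) : evZ (x + y) = evZ x + evZ y := by
  unfold evZ
  simp only [Prod.fst_add, Prod.snd_add]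
  push_cast
  ring

theorem evZ_base (i : Fin 4) : evZ (baseZ i) = baseVec i := by
  fin_cases i <;> simp [evZ, baseZ, baseVec, gold_inv]
  ring

theorem sgZ_sign (x : ℤ × ℤ) : (sgZ x : ℝ) = 1 ∨ (sgZ x : ℝ) = -1 := by
  unfold sgZ
  split_ifs
  · right; norm_num
  · left; norm_num

theorem toQ_mem (p : Fin 4 → ℤ × ℤ) (h : MemZ p) : toQ p ∈ Vcell := by
  have hs : IsSign (fun j => (sgZ (p j) : ℝ)) := fun j => sgZ_sign _
  rcases h with ⟨i, hi⟩ | h | ⟨σ, h, hσ⟩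
  · refine Or.inl ⟨_, hs, Or.inl ⟨i, fun j => ?_⟩⟩
    rw [qcoords_toQ]
    by_cases hji : j = i
    · subst hji
      have h2 := hi j
      rw [if_pos rfl] at h2 ⊢
      have h3 : evZ (p j) = 2 * sgZ (p j) := by
        conv_lhs => rw [h2]
        simp [evZ]
      rw [h3]; ring
    · have h2 := hi j
      rw [if_neg hji] at h2 ⊢
      rw [h2]; simp [evZ]
  · refine Or.inl ⟨_, hs, Or.inr fun j => ?_⟩
    rw [qcoords_toQ]
    have h3 : evZ (p j) = sgZ (p j) := by
      conv_lhs => rw [h j]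
      simp [evZ]
    rw [h3]
  · refine Or.inr ⟨σ, Equiv.Perm.mem_alternatingGroup.mpr hσ, _, hs, fun j => ?_⟩
    rw [qcoords_toQ, ← evZ_base]
    have h3 : evZ (p j) = sgZ (p j) * evZ (baseZ (σ j)) := by
      conv_lhs => rw [h j]
      simp only [evZ]
      push_cast
      ring
    rw [h3]

theorem qinner_toQ (p q : Fin 4 → ℤ × ℤ) (h : adjZ p q = true) :
    qinner (toQ p) (toQ q) = gold / 2 := by
  have h1 := congrArg evZ (of_decide_eq_true h)
  simp only [evZ_add, evZ_mul] at h1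
  have h2 : evZ (0, 2) = 2 * gold := by simp [evZ]
  rw [h2] at h1
  unfold qinner
  rw [Fin.sum_univ_four]
  simp only [qcoords_toQ]
  linarith

theorem pts_mem : ∀ n < 26, MemZ (pt n) := by decide +kernel

theorem toQ_adj (m n : ℕ) (hm : m < 26) (hn : n < 26) (h : adjZ (pt m) (pt n) = true) :
    Adj (toQ (pt m)) (toQ (pt n)) :=
  ⟨toQ_mem _ (pts_mem m hm), toQ_mem _ (pts_mem n hn), qinner_toQ _ _ h⟩

/-- The constraints on a new facet: facets already colored that are adjacent to it, and
triples of such facets that form a tetrahedron with it.  The `i`-th last facet colored is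
recorded as `4 * i`. -/
abbrev TetCon := List ℕ × List (ℕ × ℕ × ℕ)

/-- The constraints for the facets number 4, ..., 25. -/
def cons26 : List TetCon :=
  [([4, 8, 12], [(4, 8, 12)]),
   ([4, 12, 16], [(4, 12, 16)]),
   ([0, 4, 16, 20], [(0, 16, 20), (4, 16, 20)]),
   ([0, 8, 24], [(0, 8, 24)]),
   ([0, 4, 8, 28], [(0, 4, 28), (4, 8, 28)]),
   ([4, 16, 24, 32], [(4, 16, 32), (16, 24, 32)]),
   ([0, 4, 8, 36], [(0, 8, 36), (4, 8, 36)]),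
   ([0, 4, 28, 32, 40], [(0, 4, 40), (4, 32, 40), (28, 32, 40)]),
   ([0, 4, 12, 24, 32, 44], [(0, 4, 44), (0, 32, 44), (4, 12, 44), (12, 24, 44), (24, 32, 44)]),
   ([24, 28, 44], [(24, 28, 44)]),
   ([0, 28, 36, 48], [(0, 28, 48), (28, 36, 48)]),
   ([0, 28, 32, 40], [(0, 32, 40), (28, 32, 40)]),
   ([8, 28, 36, 40], [(8, 36, 40), (28, 36, 40)]),
   ([0, 4, 32, 36, 40], [(0, 32, 40), (4, 36, 40), (32, 36, 40)]),
   ([0, 4, 8, 12, 16, 44], [(0, 4, 44), (0, 8, 44), (4, 16, 44), (8, 12, 44), (12, 16, 44)]),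
   ([12, 36, 44, 56], [(12, 44, 56), (36, 44, 56)]),
   ([8, 36, 44, 48], [(8, 44, 48), (36, 44, 48)]),
   ([0, 4, 40, 44, 52], [(0, 40, 52), (4, 44, 52), (40, 44, 52)]),
   ([0, 4, 8, 16, 24, 56], [(0, 4, 56), (0, 8, 56), (4, 16, 56), (8, 24, 56), (16, 24, 56)]),
   ([12, 28, 32, 72], [(12, 28, 72), (28, 32, 72)]),
   ([0, 16, 56, 76, 84], [(0, 16, 76), (16, 56, 76), (56, 76, 84)]),
   ([0, 4, 40, 80, 88, 92], [(0, 4, 80), (0, 80, 88), (4, 40, 80), (40, 80, 92), (80, 88, 92)])]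

/-- The color (4 bits) at offset `i` in a packed list of colors. -/
def look (s i : ℕ) : ℕ := Nat.land (Nat.shiftRight s i) 15

/-- Add the colors at the given offsets to the bit mask `m`. -/
def maskE (s : ℕ) (l : List ℕ) (m : ℕ) : ℕ :=
  List.rec m (fun i _ ih => Nat.lor (Nat.shiftLeft 1 (look s i)) ih) l

/-- Add the sums of the three colors at the given triples of offsets to the bit mask `m`. -/
def maskT (s : ℕ) (l : List (ℕ × ℕ × ℕ)) (m : ℕ) : ℕ :=
  List.rec m (fun t _ ih => Nat.lor (Nat.shiftLeft 1
    (Nat.xor (look s t.1) (Nat.xor (look s t.2.1) (look s t.2.2)))) ih) l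

/-- The eight odd-weight colors. -/
def cols : List ℕ := [1, 2, 4, 8, 7, 11, 13, 14]

/-- Evaluate a number first. -/
def forceN (n : ℕ) (f : ℕ → Bool) : Bool :=
  Nat.rec (f 0) (fun p _ => f (Nat.succ p)) n

/-- Try all colors that are not in the mask `m`. -/
def tryAll (m s : ℕ) (next : ℕ → Bool) (l : List ℕ) : Bool :=
  List.rec true (fun x _ ih => cond (Nat.beq (Nat.land (Nat.shiftRight m x) 1) 1) ih
    (cond (forceN (Nat.add (Nat.mul 16 s) x) next) ih false)) l

/-- The search: `true` means that no coloring avoids the bit mask `miss`. -/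
def go (miss : ℕ) (cs : List TetCon) : ℕ → Bool :=
  List.rec (fun _ => false) (fun c _ ih s =>
    forceN (maskT s c.2 (maskE s c.1 miss)) (fun m => tryAll m s ih cols)) cs

theorem forceN_eq (n : ℕ) (f : ℕ → Bool) : forceN n f = f n := by
  cases n <;> rfl

theorem testBit_lor_shift (y m x : ℕ) :
    (Nat.lor (Nat.shiftLeft 1 y) m).testBit x = true → x = y ∨ m.testBit x = true := by
  intro h
  change ((1 <<< y) ||| m).testBit x = true at h
  rw [Nat.testBit_or, Bool.or_eq_true] at h
  rcases h with h | h
  · left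
    rw [Nat.one_shiftLeft, Nat.testBit_two_pow] at h
    exact (of_decide_eq_true h).symm
  · exact Or.inr h

theorem maskE_sound (s x m : ℕ) (l : List ℕ) (h : (maskE s l m).testBit x = true) :
    (∃ i ∈ l, x = look s i) ∨ m.testBit x = true := by
  induction l with
  | nil => exact Or.inr h
  | cons i l ih =>
    rcases testBit_lor_shift _ _ _ h with h | h
    · exact Or.inl ⟨i, by simp, h⟩
    · rcases ih h with ⟨j, hj, hx⟩ | h
      · exact Or.inl ⟨j, List.mem_cons_of_mem _ hj, hx⟩
      · exact Or.inr h

theorem maskT_sound (s x m : ℕ) (l : List (ℕ × ℕ × ℕ)) (h : (maskT s l m).testBit x = true) :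
    (∃ t ∈ l, x = look s t.1 ^^^ (look s t.2.1 ^^^ look s t.2.2)) ∨ m.testBit x = true := by
  induction l with
  | nil => exact Or.inr h
  | cons i l ih =>
    rcases testBit_lor_shift _ _ _ h with h | h
    · exact Or.inl ⟨i, by simp, h⟩
    · rcases ih h with ⟨j, hj, hx⟩ | h
      · exact Or.inl ⟨j, List.mem_cons_of_mem _ hj, hx⟩
      · exact Or.inr h

theorem tryAll_sound (m s : ℕ) (next : ℕ → Bool) (l : List ℕ) (h : tryAll m s next l = true)
    (x : ℕ) (hx : x ∈ l) : m.testBit x = true ∨ next (16 * s + x) = true := by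
  induction l with
  | nil => simp at hx
  | cons y l ih =>
    change cond (Nat.beq (Nat.land (Nat.shiftRight m y) 1) 1) (tryAll m s next l)
      (cond (forceN (Nat.add (Nat.mul 16 s) y) next) (tryAll m s next l) false) = true at h
    rw [forceN_eq] at h
    have key : tryAll m s next l = true ∧ (m.testBit y = true ∨ next (16 * s + y) = true) := by
      cases hb : Nat.beq (Nat.land (Nat.shiftRight m y) 1) 1
      · rw [hb] at h
        rcases Bool.eq_false_or_eq_true (next (Nat.add (Nat.mul 16 s) y)) with hn | hn
        · rw [hn] at h
          exact ⟨h, Or.inr hn⟩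
        · rw [hn] at h; simp at h
      · rw [hb] at h
        refine ⟨h, Or.inl ?_⟩
        have h2 : m >>> y &&& 1 = 1 := Nat.eq_of_beq_eq_true hb
        rw [Nat.testBit, Nat.and_comm, h2]
        rfl
    rcases List.mem_cons.mp hx with rfl | hx
    · exact key.2
    · exact ih key.1 hx

/-- The packed list of the first `n` colors. -/
def pack (k : ℕ → ℕ) : ℕ → ℕ
  | 0 => 0
  | n + 1 => 16 * pack k n + k n

theorem look_pack (k : ℕ → ℕ) (hk : ∀ n, k n < 16) (n i : ℕ) (hi : i < n) :
    look (pack k n) (4 * i) = k (n - 1 - i) := by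
  induction i generalizing n with
  | zero =>
    obtain ⟨m, rfl⟩ : ∃ m, n = m + 1 := ⟨n - 1, by omega⟩
    change ((pack k (m + 1)) >>> (4 * 0)) &&& 15 = _
    rw [show (15 : ℕ) = 2 ^ 4 - 1 by norm_num, Nat.and_two_pow_sub_one_eq_mod]
    have := hk m
    simp only [pack, Nat.mul_zero, Nat.shiftRight_zero, Nat.add_sub_cancel, Nat.sub_zero]
    omega
  | succ i ih =>
    obtain ⟨m, rfl⟩ : ∃ m, n = m + 1 := ⟨n - 1, by omega⟩
    have h1 := ih m (by omega)
    rw [show m + 1 - 1 - (i + 1) = m - 1 - i by omega, ← h1]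
    change ((pack k (m + 1)) >>> (4 * (i + 1))) &&& 15 = ((pack k m) >>> (4 * i)) &&& 15
    rw [show 4 * (i + 1) = 4 + 4 * i by ring, Nat.shiftRight_add]
    congr 2
    rw [Nat.shiftRight_eq_div_pow]
    have := hk m
    simp only [pack]
    omega

/-- The offset `i` at step `n` denotes a facet that is adjacent to facet `n`. -/
def chkE (n i : ℕ) : Bool :=
  decide (4 * (i / 4) = i) && decide (i / 4 < n) && adjZ (pt (n - 1 - i / 4)) (pt n)

/-- The facets at offsets `i`, `j` are adjacent. -/
def chkP (n i j : ℕ) : Bool := adjZ (pt (n - 1 - i / 4)) (pt (n - 1 - j / 4))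

/-- The constraints come from the adjacency graph. -/
def chk : List TetCon → ℕ → Bool
  | [], _ => true
  | c :: cs, n => decide (n < 26) && (c.1.all (chkE n)) &&
      (c.2.all fun t => chkE n t.1 && chkE n t.2.1 && chkE n t.2.2 &&
        chkP n t.1 t.2.1 && chkP n t.1 t.2.2 && chkP n t.2.1 t.2.2) && chk cs (n + 1)

theorem chk_cons26 : chk cons26 4 = true := by decide +kernel

/-- A sequence of colors satisfying the constraints given by the graph. -/
structure Good (k : ℕ → ℕ) : Prop where
  mem : ∀ n, k n ∈ cols
  edge : ∀ m n, m < 26 → n < 26 → adjZ (pt m) (pt n) = true → k n ≠ k m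
  tet : ∀ a b c n, a < 26 → b < 26 → c < 26 → n < 26 →
    adjZ (pt a) (pt b) = true → adjZ (pt a) (pt c) = true → adjZ (pt a) (pt n) = true →
    adjZ (pt b) (pt c) = true → adjZ (pt b) (pt n) = true → adjZ (pt c) (pt n) = true →
    k n ≠ k a ^^^ (k b ^^^ k c)

theorem cols_lt : ∀ x ∈ cols, x < 16 := by decide

theorem go_sound (k : ℕ → ℕ) (hk : Good k) (miss : ℕ) (hmiss : ∀ n, miss.testBit (k n) = false)
    (cs : List TetCon) (n : ℕ) (hc : chk cs n = true) : go miss cs (pack k n) = false := by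
  induction cs generalizing n with
  | nil => rfl
  | cons c cs ih =>
    simp only [chk, Bool.and_eq_true, List.all_eq_true, decide_eq_true_eq, chkE, chkP] at hc
    obtain ⟨⟨⟨hn, hE⟩, hT⟩, hc⟩ := hc
    by_contra hgo
    rw [Bool.not_eq_false] at hgo
    change forceN (maskT (pack k n) c.2 (maskE (pack k n) c.1 miss))
      (fun m => tryAll m (pack k n) (go miss cs) cols) = true at hgo
    rw [forceN_eq] at hgo
    have hl : ∀ i, 4 * (i / 4) = i → i / 4 < n → look (pack k n) i = k (n - 1 - i / 4) := by
      intro i h1 h2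
      have h3 := look_pack k (fun n => cols_lt _ (hk.mem n)) n (i / 4) h2
      rwa [h1] at h3
    rcases tryAll_sound _ _ _ _ hgo (k n) (hk.mem n) with h | h
    · rcases maskT_sound _ _ _ _ h with ⟨t, ht, h⟩ | h
      · obtain ⟨⟨⟨⟨⟨⟨⟨h1, h2⟩, h3⟩, ⟨h4, h5⟩, h6⟩, ⟨h7, h8⟩, h9⟩, h10⟩, h11⟩, h12⟩ := hT t ht
        rw [hl _ h1 h2, hl _ h4 h5, hl _ h7 h8] at h
        exact hk.tet _ _ _ n (by omega) (by omega) (by omega) hn h10 h11 h3 h12 h6 h9 h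
      · rcases maskE_sound _ _ _ _ h with ⟨i, hi, h⟩ | h
        · obtain ⟨⟨h1, h2⟩, h3⟩ := hE i hi
          rw [hl _ h1 h2] at h
          exact hk.edge _ n (by omega) hn h3 h
        · rw [hmiss] at h
          exact Bool.noConfusion h
    · have h2 := ih (n + 1) hc
      rw [pack, h] at h2
      exact Bool.noConfusion h2

set_option maxRecDepth 100000 in
theorem run7 : go 128 cons26 4680 = true := by decide +kernel

set_option maxRecDepth 100000 in
theorem run11 : go 2048 cons26 4680 = true := by decide +kernel

set_option maxRecDepth 100000 in
theorem run13 : go 8192 cons26 4680 = true := by decide +kernel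

set_option maxRecDepth 100000 in
theorem run14 : go 16384 cons26 4680 = true := by decide +kernel

/-- A good sequence of colors starting with the basis uses all other colors. -/
theorem good_uses (k : ℕ → ℕ) (hk : Good k) (h0 : k 0 = 1) (h1 : k 1 = 2) (h2 : k 2 = 4)
    (h3 : k 3 = 8) (x : ℕ) (hx : x ∈ cols) : ∃ n, k n = x := by
  by_contra hne
  push Not at hne
  have hp : pack k 4 = 4680 := by simp [pack, h0, h1, h2, h3]
  have hm : ∀ n, (2 ^ x).testBit (k n) = false := by
    intro n
    rw [Nat.testBit_two_pow]
    exact decide_eq_false fun h => hne n h.symm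
  have hgo := go_sound k hk _ hm cons26 4 chk_cons26
  rw [hp] at hgo
  simp only [cols, List.mem_cons, List.not_mem_nil, or_false] at hx
  rcases hx with rfl | rfl | rfl | rfl | rfl | rfl | rfl | rfl
  · exact hne 0 h0
  · exact hne 1 h1
  · exact hne 2 h2
  · exact hne 3 h3
  · exact Bool.noConfusion (hgo.symm.trans run7)
  · exact Bool.noConfusion (hgo.symm.trans run11)
  · exact Bool.noConfusion (hgo.symm.trans run13)
  · exact Bool.noConfusion (hgo.symm.trans run14)

/-- A vector of `(ℤ/2)⁴` as a 4-bit number. -/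
def code (v : Fin 4 → ZMod 2) : ℕ :=
  (v 0).val + 2 * (v 1).val + 4 * (v 2).val + 8 * (v 3).val

theorem code_add : ∀ u v : Fin 4 → ZMod 2, code (u + v) = code u ^^^ code v := by
  decide +kernel

theorem code_odd : ∀ v : Fin 4 → ZMod 2, ∑ i, v i = 1 → code v ∈ cols := by decide +kernel

theorem code_inj : ∀ u v : Fin 4 → ZMod 2, code u = code v → u = v := by decide +kernel

/-- The eight odd-weight vectors. -/
def oddSet : Finset (Fin 4 → ZMod 2) :=
  {e 0, e 1, e 2, e 3, e 0 + e 1 + e 2, e 0 + e 1 + e 3, e 0 + e 2 + e 3, e 1 + e 2 + e 3}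

theorem mem_oddSet : ∀ v : Fin 4 → ZMod 2, v ∈ oddSet ↔ ∑ i, v i = 1 := by decide +kernel

theorem card_oddSet : oddSet.card = 8 := by decide +kernel

theorem code_e : code (e 0) = 1 ∧ code (e 1) = 2 ∧ code (e 2) = 4 ∧ code (e 3) = 8 := by
  decide +kernel

theorem self_add (v : Fin 4 → ZMod 2) : v + v = 0 := CharTwo.add_self_eq_zero v

theorem adj_start : adjZ (pt 0) (pt 1) = true ∧ adjZ (pt 0) (pt 2) = true ∧
    adjZ (pt 0) (pt 3) = true ∧ adjZ (pt 1) (pt 2) = true ∧ adjZ (pt 1) (pt 3) = true ∧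
    adjZ (pt 2) (pt 3) = true := by decide +kernel

/-- Every one of the 26 facets lies with each neighbor among them in a tetrahedron of them. -/
theorem edge_tet : ∀ m n : Fin 26, adjZ (pt m) (pt n) = true → ∃ b c : Fin 26,
    adjZ (pt m) (pt b) = true ∧ adjZ (pt m) (pt c) = true ∧
    adjZ (pt n) (pt b) = true ∧ adjZ (pt n) (pt c) = true ∧ adjZ (pt b) (pt c) = true := by
  decide +kernel

theorem colors_eq (lam : ℍ[ℝ] → (Fin 4 → ZMod 2)) (hN : Nonsingular lam)
    (hO : OrientableColoring lam) :
    ∃ g : (Fin 4 → ZMod 2) ≃ₗ[ZMod 2] (Fin 4 → ZMod 2),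
      (fun x => g (lam x)) '' Vcell = (oddSet : Set (Fin 4 → ZMod 2)) := by
  obtain ⟨f, hf⟩ := hO
  have hQ : ∀ n < 26, toQ (pt n) ∈ Vcell := fun n hn => toQ_mem _ (pts_mem n hn)
  have hA := toQ_adj
  obtain ⟨a1, a2, a3, a4, a5, a6⟩ := adj_start
  have hLI := hN.2 _ _ _ _ (hA 0 1 (by norm_num) (by norm_num) a1)
    (hA 0 2 (by norm_num) (by norm_num) a2) (hA 0 3 (by norm_num) (by norm_num) a3)
    (hA 1 2 (by norm_num) (by norm_num) a4) (hA 1 3 (by norm_num) (by norm_num) a5)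
    (hA 2 3 (by norm_num) (by norm_num) a6)
  let B := basisOfLinearIndependentOfCardEqFinrank hLI (by simp)
  have hB : ∀ i, B i = ![lam (toQ (pt 0)), lam (toQ (pt 1)), lam (toQ (pt 2)),
      lam (toQ (pt 3))] i := fun i => by
    simp [B]
  let g := B.equivFun
  have hge : ∀ i, g (B i) = e i := by
    intro i
    ext j
    simp [g, e, Pi.single_apply, eq_comm]
  have g0 : g (lam (toQ (pt 0))) = e 0 := by rw [← hge 0, hB]; rfl
  have g1 : g (lam (toQ (pt 1))) = e 1 := by rw [← hge 1, hB]; rfl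
  have g2 : g (lam (toQ (pt 2))) = e 2 := by rw [← hge 2, hB]; rfl
  have g3 : g (lam (toQ (pt 3))) = e 3 := by rw [← hge 3, hB]; rfl
  have hFB : ∀ i, ∑ j, f (B i) j = 1 := by
    intro i
    rw [hB]
    fin_cases i
    · exact hf _ (hQ 0 (by norm_num))
    · exact hf _ (hQ 1 (by norm_num))
    · exact hf _ (hQ 2 (by norm_num))
    · exact hf _ (hQ 3 (by norm_num))
  have hF : ∀ v, ∑ j, f v j = ∑ i, g v i := by
    intro v
    conv_lhs => rw [← B.sum_equivFun v]
    simp only [map_sum, map_smul, Finset.sum_apply, Pi.smul_apply]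
    rw [Finset.sum_comm]
    refine Finset.sum_congr rfl fun i _ => ?_
    rw [← Finset.smul_sum, hFB]
    simp [g]
  have hodd : ∀ x ∈ Vcell, ∑ i, g (lam x) i = 1 := fun x hx => by rw [← hF]; exact hf x hx
  -- the color sequence
  let k : ℕ → ℕ := fun n => code (g (lam (toQ (pt (n % 26)))))
  have hkn : ∀ n < 26, k n = code (g (lam (toQ (pt n)))) := fun n hn => by
    simp only [k, Nat.mod_eq_of_lt hn]
  have htet : ∀ a b c n, a < 26 → b < 26 → c < 26 → n < 26 →
      adjZ (pt a) (pt b) = true → adjZ (pt a) (pt c) = true → adjZ (pt a) (pt n) = true →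
      adjZ (pt b) (pt c) = true → adjZ (pt b) (pt n) = true → adjZ (pt c) (pt n) = true →
      LinearIndependent (ZMod 2) ![lam (toQ (pt a)), lam (toQ (pt b)), lam (toQ (pt c)),
        lam (toQ (pt n))] := by
    intro a b c n ha hb hc hn h1 h2 h3 h4 h5 h6
    exact hN.2 _ _ _ _ (hA a b ha hb h1) (hA a c ha hc h2) (hA a n ha hn h3)
      (hA b c hb hc h4) (hA b n hb hn h5) (hA c n hc hn h6)
  have hgood : Good k := by
    refine ⟨fun n => ?_, ?_, ?_⟩
    · exact code_odd _ (hodd _ (hQ _ (Nat.mod_lt _ (by norm_num))))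
    · intro m n hm hn hadj heq
      rw [hkn m hm, hkn n hn] at heq
      have h := g.injective (code_inj _ _ heq)
      obtain ⟨⟨b, hb⟩, ⟨c, hc⟩, h1, h2, h3, h4, h5⟩ := edge_tet ⟨m, hm⟩ ⟨n, hn⟩ hadj
      have hli := htet m n b c hm hn hb hc hadj h1 h2 h3 h4 h5
      have := hli.injective.ne (show (0 : Fin 4) ≠ 1 by decide)
      exact this h.symm
    · intro a b c n ha hb hc hn h1 h2 h3 h4 h5 h6 heq
      rw [hkn a ha, hkn b hb, hkn c hc, hkn n hn, ← code_add, ← code_add] at heq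
      have h := code_inj _ _ heq
      rw [← map_add, ← map_add] at h
      have h := g.injective h
      have hli := htet a b c n ha hb hc hn h1 h2 h3 h4 h5 h6
      have h7 := Fintype.linearIndependent_iff.mp hli (fun _ => 1) (by
        rw [Fin.sum_univ_four]
        simp only [one_smul]
        change lam (toQ (pt a)) + lam (toQ (pt b)) + lam (toQ (pt c)) + lam (toQ (pt n)) = 0
        rw [h, add_assoc (lam (toQ (pt a))), self_add]) 0
      exact one_ne_zero h7
  obtain ⟨c0, c1, c2, c3⟩ := code_e
  have k0 : k 0 = 1 := by rw [hkn 0 (by norm_num), g0, c0]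
  have k1 : k 1 = 2 := by rw [hkn 1 (by norm_num), g1, c1]
  have k2 : k 2 = 4 := by rw [hkn 2 (by norm_num), g2, c2]
  have k3 : k 3 = 8 := by rw [hkn 3 (by norm_num), g3, c3]
  refine ⟨g, Set.Subset.antisymm ?_ ?_⟩
  · rintro _ ⟨x, hx, rfl⟩
    exact Finset.mem_coe.mpr ((mem_oddSet _).mpr (hodd x hx))
  · intro v hv
    have hv := (mem_oddSet _).mp (Finset.mem_coe.mp hv)
    obtain ⟨n, hn⟩ := good_uses k hgood k0 k1 k2 k3 (code v) (code_odd v hv)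
    exact ⟨_, hQ _ (Nat.mod_lt n (by norm_num)), code_inj _ _ hn⟩

/-- Every orientable nonsingular coloring of the 120-cell uses exactly 8 colors
and is `GL₄(ℤ/2)`-equivalent to one whose range is exactly the eight odd-weight
vectors of `(ℤ/2)⁴`. -/
theorem orientable_coloring_range :
    ∀ lam : ℍ[ℝ] → (Fin 4 → ZMod 2), Nonsingular lam → OrientableColoring lam →
      Set.ncard (lam '' Vcell) = 8 ∧
      ∃ g : (Fin 4 → ZMod 2) ≃ₗ[ZMod 2] (Fin 4 → ZMod 2),
        (fun x => g (lam x)) '' Vcell =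
          ({e 0, e 1, e 2, e 3, e 0 + e 1 + e 2, e 0 + e 1 + e 3,
            e 0 + e 2 + e 3, e 1 + e 2 + e 3} : Set (Fin 4 → ZMod 2)) := by
  intro lam hN hO
  obtain ⟨g, hg⟩ := colors_eq lam hN hO
  refine ⟨?_, g, ?_⟩
  · have h1 : (fun x => g (lam x)) '' Vcell = g '' (lam '' Vcell) := by
      rw [Set.image_image]
    rw [← Set.ncard_image_of_injective _ g.injective, ← h1, hg, Set.ncard_coe_finset, card_oddSet]
  · rw [hg]
    simp [oddSet]
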